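/- arXiv:1301.0241 — 2 statements merged into one kernel-verified Lean document; each statement's English description precedes it below -/
import Mathlib

section
/- Let A and B be densely defined normal operators on a complex Hilbert space H satisfying AB* = B*A (as an equality of operators, with equal domains). Assume B is invertible, i.e., B is injective, surjective onto H, and its inverse B⁻¹ is an everywhere-defined bounded operator on H. Let D be a dense linear subspace contained in D(A*A) ∩ D(B*A) ∩ D(A*B) ∩ D(B*B). If D is a core for (A+B)* (A+B)‾, then A+B (with domain D(A) ∩ D(B)) is essentially normal, i.e., the closure of A+B is normal. -/
open LinearPMap
open scoped InnerProductSpace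

variable {H : Type*} [NormedAddCommGroup H] [InnerProductSpace ℂ H] [CompleteSpace H]

/-- The product `S * T` of unbounded operators, with domain
`{x ∈ D(T) : T x ∈ D(S)}` and value `x ↦ S (T x)`. -/
noncomputable def LinearPMap.pmul (S T : H →ₗ.[ℂ] H) : H →ₗ.[ℂ] H :=
  S.comp (T.domRestrict ((Submodule.comap T.toFun S.domain).map T.domain.subtype))
    (fun x => by
      obtain ⟨y, hy, hyx⟩ := x.2.1
      have h : T.domRestrict _ x = T y := LinearPMap.domRestrict_apply hyx.symm
      rw [h]; exact hy)

/-- A densely defined closed operator `S` is normal if `S* S = S S*`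
(as operators, with equal domains). -/
structure LinearPMap.IsNormalOp (S : H →ₗ.[ℂ] H) : Prop where
  dense : Dense (S.domain : Set H)
  isClosed : S.IsClosed
  adjoint_mul_comm : S†.pmul S = S.pmul S†

namespace LinearPMap

theorem mem_graph_pmul {E : Type*} [NormedAddCommGroup E] [InnerProductSpace ℂ E]
    {S T : E →ₗ.[ℂ] E} {x z : E} :
    (x, z) ∈ (S.pmul T).graph ↔ ∃ y, (x, y) ∈ T.graph ∧ (y, z) ∈ S.graph := by
  constructor
  · rw [mem_graph_iff]
    rintro ⟨⟨x', hx⟩, rfl, rfl⟩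
    obtain ⟨⟨y, hy, hyx⟩, hxT⟩ := id hx
    have h : T.domRestrict _ ⟨x', hx⟩ = T ⟨x', hxT⟩ := domRestrict_apply rfl
    have hmem : T ⟨x', hxT⟩ ∈ S.domain := by
      obtain rfl : y = ⟨x', hxT⟩ := Subtype.ext hyx
      exact hy
    refine ⟨T ⟨x', hxT⟩, mem_graph T ⟨x', hxT⟩, ?_⟩
    rw [mem_graph_iff]
    exact ⟨⟨_, hmem⟩, rfl, congrArg S (Subtype.ext h.symm)⟩
  · simp only [mem_graph_iff]
    rintro ⟨_, ⟨⟨x', hx⟩, rfl, rfl⟩, ⟨⟨y, hy⟩, hyx, rfl⟩⟩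
    dsimp only at hyx
    subst hyx
    have hx' : x' ∈ (S.pmul T).domain := ⟨⟨⟨x', hx⟩, hy, rfl⟩, hx⟩
    exact ⟨⟨x', hx'⟩, rfl, congrArg S (Subtype.ext (domRestrict_apply rfl))⟩

theorem mem_graph_add {E : Type*} [NormedAddCommGroup E] [InnerProductSpace ℂ E]
    {S T : E →ₗ.[ℂ] E} {x y z : E} (hS : (x, y) ∈ S.graph)
    (hT : (x, z) ∈ T.graph) : (x, y + z) ∈ (S + T).graph := by
  simp only [mem_graph_iff] at *
  obtain ⟨⟨x', hx⟩, rfl, rfl⟩ := hS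
  obtain ⟨⟨x'', hx'⟩, hxx, rfl⟩ := hT
  dsimp only at hxx
  subst hxx
  exact ⟨⟨x'', hx, hx'⟩, rfl, rfl⟩

theorem mem_graph_adjoint_iff {T : H →ₗ.[ℂ] H} (hT : Dense (T.domain : Set H)) {y w : H} :
    (y, w) ∈ T†.graph ↔ ∀ x z, (x, z) ∈ T.graph → ⟪w, x⟫_ℂ = ⟪y, z⟫_ℂ := by
  rw [adjoint_graph_eq_graph_adjoint hT, Submodule.mem_adjoint_iff]
  refine forall₃_congr fun x z _ => ?_
  rw [sub_eq_zero, ← inner_conj_symm w, ← inner_conj_symm y, (starRingEnd ℂ).injective.eq_iff,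
    eq_comm]

/-- The graph of a closed operator `T` and the rotated graph of `T†` span the whole space. -/
theorem exists_graph_decomposition {T : H →ₗ.[ℂ] H} (hT : Dense (T.domain : Set H))
    (hc : T.IsClosed) (u v : H) :
    ∃ x z y w, (x, z) ∈ T.graph ∧ (y, w) ∈ T†.graph ∧ x - w = u ∧ z + y = v := by
  let e := WithLp.prodContinuousLinearEquiv 2 ℂ H H
  let G : Submodule ℂ (WithLp 2 (H × H)) := T.graph.comap e.toLinearMap
  have hG : _root_.IsClosed (G : Set (WithLp 2 (H × H))) := hc.preimage e.continuous
  have : CompleteSpace G := hG.completeSpace_coe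
  obtain ⟨a, ha, b, hb, hab⟩ := G.exists_add_mem_mem_orthogonal (WithLp.toLp 2 (u, v))
  have h1 := congrArg WithLp.fst hab
  have h2 := congrArg WithLp.snd hab
  refine ⟨a.fst, a.snd, b.snd, -b.fst, ha, ?_, by simpa using h1.symm, by simpa using h2.symm⟩
  rw [mem_graph_adjoint_iff hT]
  intro x z hxz
  have h := (Submodule.mem_orthogonal' G b).1 hb (WithLp.toLp 2 (x, z)) hxz
  rw [WithLp.prod_inner_apply] at h
  rw [inner_neg_left]
  exact neg_eq_of_add_eq_zero_right h

/-- A closed operator is normal as soon as `T T†` extends `T† T` on a core of `T† T`. -/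
theorem isNormalOp_of_hasCore {T : H →ₗ.[ℂ] H} (hT : Dense (T.domain : Set H))
    (hc : T.IsClosed) {D : Submodule ℂ H} (hcore : (T†.pmul T).HasCore D)
    (hD : ∀ d ∈ D, ∀ z, (d, z) ∈ (T†.pmul T).graph → (d, z) ∈ (T.pmul T†).graph) :
    T.IsNormalOp := by
  have adj {y w x z : H} (h : (y, w) ∈ T†.graph) (h' : (x, z) ∈ T.graph) :
      ⟪w, x⟫_ℂ = ⟪y, z⟫_ℂ := (mem_graph_adjoint_iff hT).1 h x z h'
  have adj' {y w x z : H} (h : (y, w) ∈ T†.graph) (h' : (x, z) ∈ T.graph) :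
      ⟪x, w⟫_ℂ = ⟪z, y⟫_ℂ := by
    rw [← inner_conj_symm x, adj h h', inner_conj_symm]
  have symm {x x' y y' : H} (h : (x, x') ∈ (T†.pmul T).graph) (h' : (y, y') ∈ (T†.pmul T).graph) :
      ⟪x', y⟫_ℂ = ⟪x, y'⟫_ℂ := by
    obtain ⟨a, ha, ha'⟩ := mem_graph_pmul.1 h
    obtain ⟨b, hb, hb'⟩ := mem_graph_pmul.1 h'
    rw [adj ha' hb, adj' hb' ha]
  have symm' {x x' y y' : H} (h : (x, x') ∈ (T.pmul T†).graph) (h' : (y, y') ∈ (T.pmul T†).graph) :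
      ⟪x', y⟫_ℂ = ⟪x, y'⟫_ℂ := by
    obtain ⟨a, ha, ha'⟩ := mem_graph_pmul.1 h
    obtain ⟨b, hb, hb'⟩ := mem_graph_pmul.1 h'
    rw [← adj' hb ha', adj ha hb']
  have surj (v : H) : ∃ x x', (x, x') ∈ (T†.pmul T).graph ∧ x + x' = v := by
    obtain ⟨x, z, y, w, h, h', h1, h2⟩ := exists_graph_decomposition hT hc v 0
    refine ⟨x, -w, mem_graph_pmul.2 ⟨z, h, ?_⟩, by rw [← h1, sub_eq_add_neg]⟩
    rw [eq_neg_of_add_eq_zero_left h2]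
    exact T†.graph.neg_mem h'
  have surj' (v : H) : ∃ x x', (x, x') ∈ (T.pmul T†).graph ∧ x + x' = v := by
    obtain ⟨x, z, y, w, h, h', h1, h2⟩ := exists_graph_decomposition hT hc 0 v
    obtain rfl := sub_eq_zero.1 h1
    exact ⟨y, z, mem_graph_pmul.2 ⟨x, h', h⟩, by rw [← h2, add_comm]⟩
  have core : (T†.pmul T).graph ≤ ((T†.pmul T).domRestrict D).graph.topologicalClosure := by
    by_cases hcl : ((T†.pmul T).domRestrict D).IsClosable
    · rw [hcl.graph_closure_eq_closure_graph, hcore.closure_eq]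
    · have := hcore.closure_eq
      rw [closure_def' hcl] at this
      nth_rw 1 [← this]
      exact Submodule.le_topologicalClosure _
  have orth {a : H} (h : ∀ d d', d ∈ D → (d, d') ∈ (T†.pmul T).graph → ⟪a, d + d'⟫_ℂ = 0) :
      a = 0 := by
    have hclosed : _root_.IsClosed {p : H × H | ⟪a, p.1 + p.2⟫_ℂ = 0} :=
      isClosed_eq (by fun_prop) continuous_const
    have hsub : (((T†.pmul T).domRestrict D).graph : Set (H × H)) ⊆
        {p : H × H | ⟪a, p.1 + p.2⟫_ℂ = 0} := by
      rintro ⟨d, d'⟩ hd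
      refine h d d' ?_ (le_graph_of_le domRestrict_le hd)
      exact (mem_domain_of_mem_graph hd).1
    obtain ⟨x, x', hx, rfl⟩ := surj a
    have := closure_minimal hsub hclosed (core hx)
    exact inner_self_eq_zero.1 this
  have le : (T.pmul T†).graph ≤ (T†.pmul T).graph := by
    rintro ⟨y, y'⟩ hy
    obtain ⟨x, x', hx, hxy⟩ := surj (y + y')
    have hxy' : x - y = 0 := orth fun d d' hdD hd => by
      have e1 := symm hx hd
      have e2 := symm' hy (hD d hdD d' hd)
      have e3 : ⟪x + x', d⟫_ℂ = ⟪y + y', d⟫_ℂ := by rw [hxy]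
      simp only [inner_add_left, inner_add_right, inner_sub_left] at *
      linear_combination e3 - e1 + e2
    obtain rfl := sub_eq_zero.1 hxy'
    rwa [← add_left_cancel hxy]
  have ge : (T†.pmul T).graph ≤ (T.pmul T†).graph := by
    rintro ⟨x, x'⟩ hx
    obtain ⟨y, y', hy, hxy⟩ := surj' (x + x')
    have hxy' : x - y = 0 := orth fun d d' hdD hd => by
      have e1 := symm hx hd
      have e2 := symm' hy (hD d hdD d' hd)
      have e3 : ⟪x + x', d⟫_ℂ = ⟪y + y', d⟫_ℂ := by rw [hxy]
      simp only [inner_add_left, inner_add_right, inner_sub_left] at *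
      linear_combination e3 - e1 + e2
    obtain rfl := sub_eq_zero.1 hxy'
    rwa [← add_left_cancel hxy]
  exact ⟨hT, hc, eq_of_eq_graph (le_antisymm ge le)⟩

theorem adjoint_closure {T : H →ₗ.[ℂ] H} (hT : Dense (T.domain : Set H)) (hc : T.IsClosable) :
    T.closure† = T† := by
  have hT' : Dense (T.closure.domain : Set H) := hT.mono T.le_closure.1
  refine eq_of_eq_graph (le_antisymm ?_ ?_) <;> rintro ⟨y, w⟩ h
  · rw [mem_graph_adjoint_iff hT'] at h
    exact (mem_graph_adjoint_iff hT).2 fun x z hxz => h x z (le_graph_of_le T.le_closure hxz)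
  · rw [mem_graph_adjoint_iff hT] at h
    refine (mem_graph_adjoint_iff hT').2 fun x z hxz => ?_
    rw [← hc.graph_closure_eq_closure_graph] at hxz
    have hclosed : _root_.IsClosed {p : H × H | ⟪w, p.1⟫_ℂ = ⟪y, p.2⟫_ℂ} :=
      isClosed_eq (by fun_prop) (by fun_prop)
    exact closure_minimal (s := (T.graph : Set (H × H))) (fun p hp => h p.1 p.2 hp) hclosed hxz

/-- If `B` has the bounded inverse `C` and `A B† ⊂ B† A`, then `A† B ⊂ B A†`. -/
theorem pmul_adjoint_le_of_adjoint_pmul {A B : H →ₗ.[ℂ] H}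
    (hA : Dense (A.domain : Set H)) (hB : Dense (B.domain : Set H))
    (hcomm : A.pmul B† ≤ B†.pmul A) {C : H →L[ℂ] H} (hCB : ∀ x : B.domain, C (B x) = (x : H))
    (hBC : ∀ y : H, ∃ h : C y ∈ B.domain, B ⟨C y, h⟩ = y) :
    A†.pmul B ≤ B.pmul A† := by
  have hCB' {x y : H} (h : (x, y) ∈ B.graph) : C y = x := by
    rw [mem_graph_iff] at h
    obtain ⟨b, rfl, rfl⟩ := h
    exact hCB b
  have hBC' (y : H) : (C y, y) ∈ B.graph := by
    obtain ⟨h, h'⟩ := hBC y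
    exact (mem_graph_iff _).2 ⟨⟨C y, h⟩, rfl, h'⟩
  have hBCadj (x : H) : (C.adjoint x, x) ∈ B†.graph := by
    refine (mem_graph_adjoint_iff hB).2 fun b z hbz => ?_
    rw [ContinuousLinearMap.adjoint_inner_left, hCB' hbz]
  have hCadj {w v : H} (h : (w, v) ∈ B†.graph) : C.adjoint v = w := by
    refine ext_inner_right ℂ fun u => ?_
    rw [ContinuousLinearMap.adjoint_inner_left]
    exact (mem_graph_adjoint_iff hB).1 h _ _ (hBC' u)
  have hAC {x z : H} (h : (x, z) ∈ A.graph) : (C.adjoint x, C.adjoint z) ∈ A.graph := by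
    obtain ⟨w, hw, hwz⟩ := mem_graph_pmul.1
      (le_graph_of_le hcomm (mem_graph_pmul.2 ⟨x, hBCadj x, h⟩))
    rwa [hCadj hwz]
  refine le_of_le_graph ?_
  rintro ⟨x, w⟩ h
  obtain ⟨y, hxy, hyw⟩ := mem_graph_pmul.1 h
  refine mem_graph_pmul.2 ⟨C w, ?_, hBC' w⟩
  rw [← hCB' hxy]
  refine (mem_graph_adjoint_iff hA).2 fun a z haz => ?_
  rw [← ContinuousLinearMap.adjoint_inner_right, ← ContinuousLinearMap.adjoint_inner_right]
  exact (mem_graph_adjoint_iff hA).1 hyw _ _ (hAC haz)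

end LinearPMap

theorem statement8 (A B : H →ₗ.[ℂ] H)
    (hAdense : Dense (A.domain : Set H)) (hBdense : Dense (B.domain : Set H))
    (hA : A.IsNormalOp) (hB : B.IsNormalOp)
    (hcomm : A.pmul B† = B†.pmul A)
    (hBinv : ∃ C : H →L[ℂ] H, (∀ x : B.domain, C (B x) = (x : H)) ∧
      (∀ y : H, ∃ h : C y ∈ B.domain, B ⟨C y, h⟩ = y))
    (D : Submodule ℂ H) (hDdense : Dense (D : Set H))
    (hD1 : D ≤ (A†.pmul A).domain) (hD2 : D ≤ (B†.pmul A).domain)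
    (hD3 : D ≤ (A†.pmul B).domain) (hD4 : D ≤ (B†.pmul B).domain)
    (hcore : ((A + B)†.pmul (A + B).closure).HasCore D) :
    (A + B).IsClosable ∧ ((A + B).closure).IsNormalOp := by
  obtain ⟨C, hCB, hBC⟩ := hBinv
  have hAB := le_graph_of_le (pmul_adjoint_le_of_adjoint_pmul hAdense hBdense hcomm.le hCB hBC)
  have key (d : H) (hd : d ∈ D) : ∃ a b a' b' z, (d, a) ∈ A.graph ∧ (d, b) ∈ B.graph ∧
      (d, a') ∈ A†.graph ∧ (d, b') ∈ B†.graph ∧ (a + b, z) ∈ (A† + B†).graph ∧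
      (a' + b', z) ∈ (A + B).graph := by
    obtain ⟨z₁, h₁⟩ := mem_domain_iff.1 (hD1 hd)
    obtain ⟨z₂, h₂⟩ := mem_domain_iff.1 (hD2 hd)
    obtain ⟨z₃, h₃⟩ := mem_domain_iff.1 (hD3 hd)
    obtain ⟨z₄, h₄⟩ := mem_domain_iff.1 (hD4 hd)
    have h₁' := h₁
    have h₂' := h₂
    have h₃' := hAB h₃
    have h₄' := h₄
    rw [hA.adjoint_mul_comm] at h₁'
    rw [← hcomm] at h₂'
    rw [hB.adjoint_mul_comm] at h₄'
    obtain ⟨a, ha, ha₁⟩ := mem_graph_pmul.1 h₁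
    obtain ⟨a₂, ha₂, hab⟩ := mem_graph_pmul.1 h₂
    obtain ⟨b, hb, hba⟩ := mem_graph_pmul.1 h₃
    obtain ⟨b₂, hb₂, hbb⟩ := mem_graph_pmul.1 h₄
    obtain ⟨a', ha', haa'⟩ := mem_graph_pmul.1 h₁'
    obtain ⟨b', hb', hba'⟩ := mem_graph_pmul.1 h₂'
    obtain ⟨a'₂, ha'₂, hab'⟩ := mem_graph_pmul.1 h₃'
    obtain ⟨b'₂, hb'₂, hbb'⟩ := mem_graph_pmul.1 h₄'
    obtain rfl := mem_graph_snd_inj _ ha ha₂ rfl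
    obtain rfl := mem_graph_snd_inj _ hb hb₂ rfl
    obtain rfl := mem_graph_snd_inj _ ha' ha'₂ rfl
    obtain rfl := mem_graph_snd_inj _ hb' hb'₂ rfl
    refine ⟨a, b, a', b', (z₁ + z₃) + (z₂ + z₄), ha, hb, ha', hb',
      mem_graph_add (add_mem ha₁ hba) (add_mem hab hbb), ?_⟩
    rw [add_add_add_comm]
    exact mem_graph_add (add_mem haa' hba') (add_mem hab' hbb')
  have hdense : Dense ((A + B).domain : Set H) := hDdense.mono fun d hd => by
    obtain ⟨a, b, _, _, _, ha, hb, -⟩ := key d hd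
    exact ⟨mem_domain_of_mem_graph ha, mem_domain_of_mem_graph hb⟩
  have hdense' : Dense ((A† + B†).domain : Set H) := hDdense.mono fun d hd => by
    obtain ⟨_, _, a, b, _, -, -, ha, hb, -⟩ := key d hd
    exact ⟨mem_domain_of_mem_graph ha, mem_domain_of_mem_graph hb⟩
  have hformal : (A† + B†).IsFormalAdjoint (A + B) := fun x y => by
    have e₁ := adjoint_isFormalAdjoint hAdense ⟨x, x.2.1⟩ ⟨y, y.2.1⟩
    have e₂ := adjoint_isFormalAdjoint hBdense ⟨x, x.2.2⟩ ⟨y, y.2.2⟩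
    rw [LinearPMap.add_apply, LinearPMap.add_apply, inner_add_left, inner_add_right]
    exact congrArg₂ (· + ·) e₁ e₂
  have hclosable : (A + B).IsClosable :=
    (adjoint_isClosed hdense').isClosable.leIsClosable (hformal.le_adjoint hdense')
  have hadj := le_graph_of_le (hformal.symm.le_adjoint hdense)
  have hcl := le_graph_of_le (A + B).le_closure
  refine ⟨hclosable, ?_⟩
  rw [← adjoint_closure hdense hclosable] at hcore hadj
  refine isNormalOp_of_hasCore (hdense.mono (A + B).le_closure.1) hclosable.closure_isClosed
    hcore fun d hd z hz => ?_
  obtain ⟨a, b, a', b', z', ha, hb, ha', hb', h, h'⟩ := key d hd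
  obtain rfl : z' = z := mem_graph_snd_inj _
    (mem_graph_pmul.2 ⟨a + b, hcl (mem_graph_add ha hb), hadj h⟩) hz rfl
  exact mem_graph_pmul.2 ⟨a' + b', hadj (mem_graph_add ha' hb'), hcl h'⟩
end

section
/- Let A be a densely defined normal operator on a complex Hilbert space H and let B be an everywhere-defined bounded self-adjoint operator on H. If BA* ⊂ −AB (for every x ∈ D(A*): Bx ∈ D(A) and BA*x = −ABx), then BA ⊂ −A*B (for every x ∈ D(A): Bx ∈ D(A*) and BAx = −A*Bx). -/
open LinearPMap
open scoped InnerProductSpace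

variable {H : Type*} [NormedAddCommGroup H] [InnerProductSpace ℂ H] [CompleteSpace H]

section CStarAlgebra

variable {𝒜 : Type*} [CStarAlgebra 𝒜]

/-- A Fuglede–Putnam theorem with a self-adjoint weight `r`, for a cutoff `g` of `r` on which `r`
has a partial inverse `k`. -/
lemma fuglede_putnam_cutoff {r c d b g k : 𝒜} (hc : IsStarNormal c) (hd : IsStarNormal d)
    (hk : IsSelfAdjoint k) (hgr : Commute g r) (hgc : Commute g c)
    (hgd : Commute g d) (hkc : Commute k c) (hkc' : Commute k (star c)) (hkd : Commute k d)
    (hkd' : Commute k (star d)) (hgd' : Commute g (star d)) (hkr : Commute k r)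
    (hkg : Commute k g) (hrkg : r * k * g = g) (h : r * b * d = c * b * r) :
    r * g * b * star d * g = star c * g * b * r * g := by
  have hkrg : k * r * g = g := by rw [hkr.eq, hrkg]
  have hrgk : r * g * k = g := by rw [mul_assoc, ← hkg.eq, ← mul_assoc, hrkg]
  have hsemi : r * g * b * (r * g) * (d * k) = c * k * (r * g * b * (r * g)) := by
    calc r * g * b * (r * g) * (d * k) = r * g * b * (r * g * k) * d := by
          rw [← hkd.eq]; noncomm_ring
      _ = g * r * b * (g * d) := by rw [hrgk, ← hgr.eq, mul_assoc]
      _ = g * (r * b * d) * g := by rw [hgd.eq]; noncomm_ring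
      _ = g * c * b * r * g := by rw [h]; noncomm_ring
      _ = c * (k * r * g) * b * r * g := by rw [hgc.eq, hkrg]
      _ = c * k * (r * g * b * (r * g)) := by noncomm_ring
  have hnormal : ∀ x : 𝒜, IsStarNormal x → Commute k x → Commute k (star x) →
      IsStarNormal (x * k) := by
    intro x hx hkx hkx'
    refine ⟨?_⟩
    rw [star_mul, hk.star_eq]
    exact (hkx.mul_right (.refl k)).mul_left (hx.star_comm_self.mul_right hkx'.symm)
  have hstar := SemiconjBy.star_right (hnormal d hd hkd hkd') (hnormal c hc hkc hkc') hsemi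
  rw [SemiconjBy, star_mul, star_mul, hk.star_eq] at hstar
  calc r * g * b * star d * g = r * g * b * (r * g * (k * star d)) := by
        rw [← mul_assoc (r * g) k, hrgk, hgd'.eq]; noncomm_ring
    _ = k * star c * (r * g * b * (r * g)) := by rw [← hstar]; noncomm_ring
    _ = star c * (k * r * g) * b * r * g := by rw [hkc'.eq]; noncomm_ring
    _ = star c * g * b * r * g := by rw [hkrg]

/-- A Fuglede–Putnam theorem with a self-adjoint weight `r` commuting with the normal elements
`c` and `d`. -/
lemma fuglede_putnam_weighted {r c d b : 𝒜} (hr : IsSelfAdjoint r) (hc : IsStarNormal c)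
    (hd : IsStarNormal d) (hrc : Commute r c) (hrd : Commute r d)
    (h : r * b * d = c * b * r) :
    r ^ 2 * (r * b * star d - star c * b * r) * r ^ 2 = 0 := by
  have hrc' : Commute r (star c) := by simpa [hr.star_eq] using hrc.star_star
  have hrd' : Commute r (star d) := by simpa [hr.star_eq] using hrd.star_star
  let g : ℝ → 𝒜 := fun δ => cfc (fun t : ℝ => max (t ^ 2 - δ) 0) r
  have hcut : ∀ δ > 0, r * g δ * b * star d * g δ = star c * g δ * b * r * g δ := by
    intro δ hδ
    have hcont : Continuous fun t : ℝ => t / max (t ^ 2) δ :=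
      continuous_id.div (by fun_prop) fun t => (lt_max_of_lt_right hδ).ne'
    have hcont' : Continuous fun t : ℝ => max (t ^ 2 - δ) 0 := by fun_prop
    refine fuglede_putnam_cutoff (k := cfc (fun t : ℝ => t / max (t ^ 2) δ) r) hc hd
      (cfc_predicate _ _) (hr.commute_cfc (.refl r) _)
      (hr.commute_cfc hrc _) (hr.commute_cfc hrd _) (hr.commute_cfc hrc _)
      (hr.commute_cfc hrc' _) (hr.commute_cfc hrd _) (hr.commute_cfc hrd' _)
      (hr.commute_cfc hrd' _) (hr.commute_cfc (.refl r) _) (cfc_commute_cfc _ _ _) ?_ h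
    nth_rw 1 [← cfc_id ℝ r]
    rw [← cfc_mul _ _ r (by fun_prop) hcont.continuousOn, ← cfc_mul _ _ r
      (by exact (continuous_id.mul hcont).continuousOn) hcont'.continuousOn]
    refine cfc_congr fun t _ => ?_
    rcases le_total (t ^ 2) δ with ht | ht
    · simp [max_eq_right (sub_nonpos.2 ht)]
    · have : t ≠ 0 := by rintro rfl; simp at ht; linarith
      simp only [id, max_eq_left ht]
      field_simp
  have hlim : Filter.Tendsto g (nhdsWithin 0 (Set.Ioi 0)) (nhds (r ^ 2)) := by
    rw [tendsto_iff_norm_sub_tendsto_zero]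
    refine squeeze_zero' (.of_forall fun _ => norm_nonneg _) ?_
      (tendsto_nhdsWithin_of_tendsto_nhds Filter.tendsto_id)
    filter_upwards [self_mem_nhdsWithin] with δ hδ
    have hδ : 0 < δ := hδ
    rw [← cfc_pow_id (R := ℝ) r 2, ← cfc_sub _ _ r (by fun_prop) (by fun_prop)]
    refine norm_cfc_le hδ.le fun t _ => ?_
    rw [Real.norm_eq_abs, abs_le]
    constructor
    · simp only [id]; linarith [le_max_left (t ^ 2 - δ) 0]
    · have : max (t ^ 2 - δ) 0 ≤ t ^ 2 + δ := max_le (by linarith) (by positivity)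
      simp only [id]; linarith
  have heq : r * r ^ 2 * b * star d * r ^ 2 = star c * r ^ 2 * b * r * r ^ 2 := by
    refine tendsto_nhds_unique_of_eventuallyEq
      ((((hlim.const_mul r).mul_const b).mul_const (star d)).mul hlim)
      ((((hlim.const_mul (star c)).mul_const b).mul_const r).mul hlim) ?_
    filter_upwards [self_mem_nhdsWithin] with δ hδ using hcut δ hδ
  rw [← (hrc'.pow_left 2).eq] at heq
  calc _ = r * r ^ 2 * b * star d * r ^ 2 - r ^ 2 * star c * b * r * r ^ 2 := by noncomm_ring
    _ = 0 := sub_eq_zero.2 heq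

end CStarAlgebra

namespace LinearPMap

lemma mem_graph_pmul_iff {S T : H →ₗ.[ℂ] H} {x z : H} :
    (x, z) ∈ (S.pmul T).graph ↔ ∃ y, (x, y) ∈ T.graph ∧ (y, z) ∈ S.graph := by
  have key : ∀ (u : (S.pmul T).domain) (v : T.domain) (w : S.domain), (u : H) = v →
      T v = w → S.pmul T u = S w := by
    intro u v w huv hvw
    change S _ = S w
    congr 1
    ext
    rw [← hvw]
    exact domRestrict_apply huv
  constructor
  · intro h
    obtain ⟨u, hu, huz⟩ := (mem_graph_iff _).1 h
    obtain ⟨v, hv, hvu⟩ := u.2.1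
    have hvu : (v : H) = u := hvu
    have hv : T v ∈ S.domain := hv
    refine ⟨T v, ?_, ?_⟩
    · simpa [hvu, show (u : H) = x from hu] using T.mem_graph v
    · have := key u v ⟨T v, hv⟩ hvu.symm rfl
      rw [← show S.pmul T u = z from huz, this]
      exact S.mem_graph ⟨T v, hv⟩
  · rintro ⟨y, hxy, hyz⟩
    obtain ⟨v, rfl, rfl⟩ := (mem_graph_iff _).1 hxy
    obtain ⟨w, hw, rfl⟩ := (mem_graph_iff _).1 hyz
    have hw : (w : H) = T v := hw
    have hu : (v : H) ∈ (S.pmul T).domain :=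
      ⟨⟨v, show T v ∈ S.domain from hw ▸ w.2, rfl⟩, v.2⟩
    have := key ⟨v, hu⟩ v w rfl hw.symm
    simpa [← this] using (S.pmul T).mem_graph ⟨v, hu⟩

lemma mem_graph_adjoint_iff_s13 {A : H →ₗ.[ℂ] H} (hA : Dense (A.domain : Set H)) {u w : H} :
    (u, w) ∈ A†.graph ↔ ∀ a b, (a, b) ∈ A.graph → ⟪b, u⟫_ℂ = ⟪a, w⟫_ℂ := by
  simp [adjoint_graph_eq_graph_adjoint hA, sub_eq_zero]

/-- The orthogonal projection onto the graph of a closed operator. -/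
lemma IsClosed.exists_graph_projection {A : H →ₗ.[ℂ] H} (hA : A.IsClosed) :
    ∃ P : H × H →L[ℂ] H × H, ∀ a, P a ∈ A.graph ∧
      ∀ v ∈ A.graph, ⟪v.1, a.1 - (P a).1⟫_ℂ + ⟪v.2, a.2 - (P a).2⟫_ℂ = 0 := by
  let e := WithLp.prodContinuousLinearEquiv 2 ℂ H H
  let G : Submodule ℂ (WithLp 2 (H × H)) := A.graph.comap (e : WithLp 2 (H × H) →ₗ[ℂ] H × H)
  have hG : _root_.IsClosed (G : Set (WithLp 2 (H × H))) := hA.preimage e.continuous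
  have : CompleteSpace G := hG.completeSpace_coe
  refine ⟨(e : WithLp 2 (H × H) →L[ℂ] H × H) ∘L G.starProjection ∘L
    (e.symm : H × H →L[ℂ] WithLp 2 (H × H)), fun a => ⟨?_, fun v hv => ?_⟩⟩
  · exact G.starProjection_apply_mem (e.symm a)
  · have := (G.mem_orthogonal _).1 (G.sub_starProjection_mem_orthogonal (e.symm a)) (e.symm v)
      (by simpa [G] using hv)
    exact this

lemma eq_zero_of_mem_graph_of_neg_mem_graph_adjoint {A : H →ₗ.[ℂ] H}
    (hA : Dense (A.domain : Set H)) {x y : H} (hxy : (x, y) ∈ A.graph)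
    (hyx : (y, -x) ∈ A†.graph) : x = 0 ∧ y = 0 := by
  have h := (mem_graph_adjoint_iff_s13 hA).1 hyx x y hxy
  rw [inner_neg_right, inner_self_eq_norm_sq_to_K, inner_self_eq_norm_sq_to_K] at h
  have h' : ‖y‖ ^ 2 = -‖x‖ ^ 2 := by exact_mod_cast h
  constructor <;> rw [← norm_eq_zero] <;> nlinarith [sq_nonneg ‖x‖, sq_nonneg ‖y‖]

/-- `R = (1 + A* A)⁻¹` and `C = A R`, for a densely defined closed operator `A`. -/
structure IsResolventPair (A : H →ₗ.[ℂ] H) (R C : H →L[ℂ] H) : Prop where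
  mem_graph : ∀ h, (R h, C h) ∈ A.graph
  mem_graph_adjoint : ∀ h, (C h, h - R h) ∈ A†.graph

lemma IsClosed.exists_isResolventPair {A : H →ₗ.[ℂ] H} (hA : A.IsClosed)
    (hd : Dense (A.domain : Set H)) : ∃ R C, A.IsResolventPair R C := by
  obtain ⟨P, hP⟩ := hA.exists_graph_projection
  refine ⟨.fst ℂ H H ∘L P ∘L .inl ℂ H H, .snd ℂ H H ∘L P ∘L .inl ℂ H H, fun h => (hP (h, 0)).1,
    fun h => (mem_graph_adjoint_iff_s13 hd).2 fun a b hab => ?_⟩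
  have := (hP (h, 0)).2 (a, b) hab
  simp only [zero_sub, inner_neg_right] at this
  exact (add_neg_eq_zero.1 this).symm

namespace IsResolventPair

variable {A : H →ₗ.[ℂ] H} {R C : H →L[ℂ] H}

lemma inner_eq (hRC : A.IsResolventPair R C) (hd : Dense (A.domain : Set H)) (x h : H) :
    ⟪C x, C h⟫_ℂ = ⟪R x, h - R h⟫_ℂ :=
  (mem_graph_adjoint_iff_s13 hd).1 (hRC.mem_graph_adjoint h) _ _ (hRC.mem_graph x)

lemma isSelfAdjoint (hRC : A.IsResolventPair R C) (hd : Dense (A.domain : Set H)) :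
    IsSelfAdjoint R := by
  rw [ContinuousLinearMap.isSelfAdjoint_iff_isSymmetric]
  intro x y
  have h1 := hRC.inner_eq hd x y
  have h2 := congrArg (starRingEnd ℂ) (hRC.inner_eq hd y x)
  rw [inner_conj_symm, inner_conj_symm, inner_sub_left] at h2
  rw [inner_sub_right] at h1
  change ⟪R x, y⟫_ℂ = ⟪x, R y⟫_ℂ
  linear_combination h2 - h1

lemma eq_of_mem_graph (hRC : A.IsResolventPair R C) (hd : Dense (A.domain : Set H)) {x y h : H}
    (hxy : (x, y) ∈ A.graph) (hyx : (y, h - x) ∈ A†.graph) : x = R h := by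
  refine sub_eq_zero.1 (eq_zero_of_mem_graph_of_neg_mem_graph_adjoint hd
    (A.graph.sub_mem hxy (hRC.mem_graph h)) ?_).1
  simpa using (A†).graph.sub_mem hyx (hRC.mem_graph_adjoint h)

lemma injective (hRC : A.IsResolventPair R C) : Function.Injective R := by
  rw [injective_iff_map_eq_zero]
  intro h hR
  have h1 := hRC.mem_graph h
  have h2 := hRC.mem_graph_adjoint h
  rw [hR] at h1 h2
  rw [A.graph_fst_eq_zero_snd h1 rfl, sub_zero] at h2
  exact (A†).graph_fst_eq_zero_snd h2 rfl

lemma eq_zero_of_mul_eq_zero (hRC : A.IsResolventPair R C) {X : H →L[ℂ] H} (h : R * X = 0) :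
    X = 0 := by
  ext x
  exact hRC.injective (by simpa using congr($h x))

lemma eq_zero_of_mul_mul_eq_zero (hRC : A.IsResolventPair R C) (hd : Dense (A.domain : Set H))
    {X : H →L[ℂ] H} (h : R * X * R = 0) : X = 0 := by
  have h1 : X * R = 0 := hRC.eq_zero_of_mul_eq_zero (by rwa [← mul_assoc])
  have h2 : R * star X = 0 := by simpa [(hRC.isSelfAdjoint hd).star_eq] using congr(star $h1)
  exact star_eq_zero.1 (hRC.eq_zero_of_mul_eq_zero h2)

/-- The range of `R` is a core for `A`, so that membership in the graph of `A*` can be tested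
on it. -/
lemma mem_graph_adjoint_of_forall (hRC : A.IsResolventPair R C) (hA : A.IsClosed)
    (hd : Dense (A.domain : Set H)) {u w : H} (h : ∀ z, ⟪C z, u⟫_ℂ = ⟪R z, w⟫_ℂ) :
    (u, w) ∈ A†.graph := by
  obtain ⟨P, hP⟩ := hA.exists_graph_projection
  obtain ⟨hp, hort⟩ := hP (w, -u)
  have hzero : ∀ z, ⟪z, (P (w, -u)).1⟫_ℂ = 0 := by
    intro z
    have h1 := hort _ (hRC.mem_graph z)
    have h2 := (mem_graph_adjoint_iff_s13 hd).1 (hRC.mem_graph_adjoint z)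
      (P (w, -u)).1 (P (w, -u)).2 hp
    have h3 := congrArg (starRingEnd ℂ) h2
    simp only [inner_sub_right, inner_neg_right, inner_conj_symm, _root_.map_sub] at h1 h3
    linear_combination -h1 - h3 - h z
  have hp1 : (P (w, -u)).1 = 0 := inner_self_eq_zero.1 (hzero _)
  have hp2 : (P (w, -u)).2 = 0 := A.graph_fst_eq_zero_snd hp hp1
  refine (mem_graph_adjoint_iff_s13 hd).2 fun a b hab => ?_
  have := hort _ hab
  simp only [hp1, hp2, sub_zero, inner_neg_right] at this
  exact (add_neg_eq_zero.1 this).symm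

lemma adjoint_mem_graph (hRC : A.IsResolventPair R C) (hA : A.IsNormalOp) (h : H) :
    (R h, star C h) ∈ A†.graph ∧ (star C h, h - R h) ∈ A.graph := by
  obtain ⟨y, hy, hy'⟩ := mem_graph_pmul_iff.1 (hA.adjoint_mul_comm ▸
    mem_graph_pmul_iff.2 ⟨_, hRC.mem_graph h, hRC.mem_graph_adjoint h⟩)
  suffices y = star C h by exact this ▸ ⟨hy, hy'⟩
  refine ext_inner_left ℂ fun x => ?_
  rw [ContinuousLinearMap.star_eq_adjoint, ContinuousLinearMap.adjoint_inner_right]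
  have h1 := (mem_graph_adjoint_iff_s13 hA.dense).1 hy _ _ (hRC.mem_graph x)
  have h2 := congrArg (starRingEnd ℂ)
    ((mem_graph_adjoint_iff_s13 hA.dense).1 (hRC.mem_graph_adjoint x) _ _ hy')
  simp only [inner_conj_symm, inner_sub_left, inner_sub_right, _root_.map_sub] at h1 h2
  linear_combination -h1 - h2

lemma apply_eq_of_mem_graph (hRC : A.IsResolventPair R C) (hA : A.IsNormalOp) {x y : H}
    (hxy : (x, y) ∈ A.graph) : R y = C x := by
  obtain ⟨w, hw, hw'⟩ := mem_graph_pmul_iff.1 (hA.adjoint_mul_comm.symm ▸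
    mem_graph_pmul_iff.2 ⟨_, hRC.mem_graph_adjoint x, A.graph.sub_mem hxy (hRC.mem_graph x)⟩)
  exact (hRC.eq_of_mem_graph hA.dense hw hw').symm

lemma commute (hRC : A.IsResolventPair R C) (hA : A.IsNormalOp) : Commute R C := by
  ext x
  exact hRC.apply_eq_of_mem_graph hA (hRC.mem_graph x)

lemma mul_star (hRC : A.IsResolventPair R C) (hA : A.IsNormalOp) : C * star C = R * (1 - R) := by
  ext x
  exact (hRC.apply_eq_of_mem_graph hA (hRC.adjoint_mem_graph hA x).2).symm

lemma star_mul (hRC : A.IsResolventPair R C) (hd : Dense (A.domain : Set H)) :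
    star C * C = R * (1 - R) := by
  ext h
  refine ext_inner_left ℂ fun x => ?_
  have hR := (ContinuousLinearMap.isSelfAdjoint_iff_isSymmetric.1 (hRC.isSelfAdjoint hd)) x (h - R h)
  simp only [mul_apply_eq_comp, ContinuousLinearMap.star_eq_adjoint,
    ContinuousLinearMap.adjoint_inner_right]
  exact (hRC.inner_eq hd x h).trans hR

end IsResolventPair

lemma IsNormalOp.neg_mem_graph_adjoint {A : H →ₗ.[ℂ] H} (hA : A.IsNormalOp) (B : H →L[ℂ] H)
    (hB : ∀ u v, (u, v) ∈ A†.graph → (B u, -B v) ∈ A.graph) {x y : H} (hxy : (x, y) ∈ A.graph) :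
    (B x, -B y) ∈ A†.graph := by
  obtain ⟨R, C, hRC⟩ := hA.isClosed.exists_isResolventPair hA.dense
  have hR := hRC.isSelfAdjoint hA.dense
  have hcomm := hRC.commute hA
  have hcomm' : Commute R (star C) := by simpa [hR.star_eq] using hcomm.star_star
  have hCC := hRC.mul_star hA
  have hCC' := hRC.star_mul hA.dense
  have hC : IsStarNormal C := ⟨by rw [Commute, SemiconjBy, hCC, hCC']⟩
  have h1 : R * B * star C = -(C * B * R) := by
    ext z
    have := hRC.apply_eq_of_mem_graph hA (hB _ _ (hRC.adjoint_mem_graph hA z).1)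
    exact neg_eq_iff_eq_neg.1 ((_root_.map_neg R _).symm.trans this)
  have h2 : R * B * C = -(star C * B * R) := by
    have hD : IsStarNormal (-star C) := ⟨by simpa using hC.star_comm_self.symm⟩
    have h := fuglede_putnam_weighted (b := B) hR hC hD hcomm hcomm'.neg_right
      (by rw [mul_neg, h1, neg_neg])
    have h' := hRC.eq_zero_of_mul_mul_eq_zero hA.dense (hRC.eq_zero_of_mul_mul_eq_zero hA.dense
      (X := R * (R * B * star (-star C) - star C * B * R) * R) (by rw [← h]; noncomm_ring))
    rw [star_neg, star_star, mul_neg] at h'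
    rw [← sub_eq_zero, ← neg_eq_zero, ← h']
    abel
  have hRB : R * B = B * R := by
    have h3 : R * R * B * (R * (1 - R)) = R * (1 - R) * B * R * R := by
      calc R * R * B * (R * (1 - R)) = R * (R * B * C) * star C := by rw [← hCC]; noncomm_ring
        _ = -(R * star C * B * (R * star C)) := by rw [h2]; noncomm_ring
        _ = -(star C * (R * B * star C) * R) := by rw [hcomm'.eq]; noncomm_ring
        _ = star C * C * B * R * R := by rw [h1]; noncomm_ring
        _ = R * (1 - R) * B * R * R := by rw [hCC']
    refine sub_eq_zero.1 (hRC.eq_zero_of_mul_mul_eq_zero hA.dense ?_)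
    rw [← sub_eq_zero] at h3
    rw [← h3]
    noncomm_ring
  have hBC : B * C = -(star C * B) := by
    refine sub_eq_zero.1 (hRC.eq_zero_of_mul_eq_zero ?_)
    rw [mul_sub, mul_neg, ← mul_assoc, ← mul_assoc, h2, hcomm'.eq, mul_assoc (star C),
      mul_assoc (star C), hRB, sub_self]
  refine hRC.mem_graph_adjoint_of_forall hA.isClosed hA.dense fun z => ?_
  have hsymm := ContinuousLinearMap.isSelfAdjoint_iff_isSymmetric.1 hR
  have h4 : R (B y) = -(star C (B x)) := by
    calc R (B y) = B (R y) := congr($hRB y)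
      _ = B (C x) := by rw [hRC.apply_eq_of_mem_graph hA hxy]
      _ = _ := congr($hBC x)
  calc ⟪C z, B x⟫_ℂ = ⟪z, star C (B x)⟫_ℂ := by
        rw [ContinuousLinearMap.star_eq_adjoint, ContinuousLinearMap.adjoint_inner_right]
    _ = ⟪z, R (-B y)⟫_ℂ := by rw [_root_.map_neg, h4, neg_neg]
    _ = ⟪R z, -B y⟫_ℂ := (hsymm z (-B y)).symm

end LinearPMap

theorem statement13 (A : H →ₗ.[ℂ] H) (hA : A.IsNormalOp)
    (B : H →L[ℂ] H) (hB : ∀ x y : H, ⟪B x, y⟫_ℂ = ⟪x, B y⟫_ℂ)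
    (hanti : ∀ x : A†.domain, ∃ h : B (x : H) ∈ A.domain,
      B (A† x) = - A ⟨B (x : H), h⟩) :
    ∀ x : A.domain, ∃ h : B (x : H) ∈ A†.domain,
      B (A x) = - A† ⟨B (x : H), h⟩ := by
  intro x
  have h := hA.neg_mem_graph_adjoint B (fun u v huv => ?_) (A.mem_graph x)
  · have hdom := mem_domain_of_mem_graph h
    exact ⟨hdom, neg_eq_iff_eq_neg.1 ((image_iff hdom).2 h)⟩
  · obtain ⟨u, rfl, rfl⟩ := (mem_graph_iff _).1 huv
    obtain ⟨hu, hBu⟩ := hanti u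
    exact (image_iff hu).1 (neg_eq_iff_eq_neg.2 hBu)
end
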